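/- arXiv:2211.07011 — 6 statements merged into one kernel-verified Lean document; each statement's English description precedes it below -/
import Mathlib

section
/- Let (X,d) be a metric space, E : X → ℝ, k > 0, and let M, N ≥ 1. Let γ_{i,j} ∈ ℝ be given for i = 1,…,N and j = −M+1,…,i−1, and set γ_{0,j} = 0 and γ_{N+1,j} = 0 for all j. Define weights w_{i,j} = γ_{i+1,j} − γ_{i,j} for i > j and w_{i,j} = 0 for i ≤ j (for i = 0,…,N and j = −M+1,…,N). Suppose v_{−M+1},…,v_N ∈ X satisfy, for each i = 1,…,N, the minimality-type inequality E(v_i) + (1/(2k)) Σ_{j=−M+1}^{i−1} γ_{i,j} d(v_i,v_j)² ≤ E(v_{i−1}) + (1/(2k)) Σ_{j=−M+1}^{i−2} γ_{i,j} d(v_{i−1},v_j)². Then E(v_N) ≤ E(v_0) + (1/(2k)) Σ_{i=0}^{N} Σ_{j=−M+1}^{N} w_{i,j} d(v_i,v_j)². -/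
/-- Summing the strictly lower triangular weights `w i j` over a row splits into two truncated sums. -/
theorem sum_strictLower_weight_mul (γ w : ℤ → ℤ → ℝ)
    (hw : ∀ i j : ℤ, w i j = if j < i then γ (i + 1) j - γ i j else 0)
    (f : ℤ → ℝ) {a b i : ℤ} (hi : i ≤ b) :
    ∑ j ∈ Finset.Icc a b, w i j * f j
      = ∑ j ∈ Finset.Icc a (i - 1), γ (i + 1) j * f j
        - ∑ j ∈ Finset.Icc a (i - 1), γ i j * f j := by
  have hsub : Finset.Icc a (i - 1) ⊆ Finset.Icc a b :=
    Finset.Icc_subset_Icc le_rfl (by lia)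
  rw [← Finset.sum_sub_distrib, ← Finset.sum_subset hsub]
  · refine Finset.sum_congr rfl fun j hj => ?_
    rw [hw, if_pos (by have := Finset.mem_Icc.1 hj; lia), sub_mul]
  · intro j hj hj'
    rw [hw, if_neg (by simp only [Finset.mem_Icc] at hj hj'; lia), zero_mul]


/-- Telescoping energy inequality for the M-step N-stage variational scheme. -/
theorem energy_telescoping_inequality
    {X : Type*} [MetricSpace X] (E : X → ℝ) (k : ℝ) (hk : 0 < k)
    (M N : ℕ) (hM : 1 ≤ M) (hN : 1 ≤ N)
    (γ : ℤ → ℤ → ℝ) (hγ0 : ∀ j : ℤ, γ 0 j = 0) (hγN : ∀ j : ℤ, γ ((N : ℤ) + 1) j = 0)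
    (w : ℤ → ℤ → ℝ)
    (hw : ∀ i j : ℤ, w i j = if j < i then γ (i + 1) j - γ i j else 0)
    (v : ℤ → X)
    (hmin : ∀ i ∈ Finset.Icc (1 : ℤ) (N : ℤ),
      E (v i) + (1 / (2 * k)) *
          ∑ j ∈ Finset.Icc (-(M : ℤ) + 1) (i - 1), γ i j * dist (v i) (v j) ^ 2
        ≤ E (v (i - 1)) + (1 / (2 * k)) *
          ∑ j ∈ Finset.Icc (-(M : ℤ) + 1) (i - 2), γ i j * dist (v (i - 1)) (v j) ^ 2) :
    E (v (N : ℤ)) ≤ E (v 0) + (1 / (2 * k)) *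
      ∑ i ∈ Finset.Icc (0 : ℤ) (N : ℤ), ∑ j ∈ Finset.Icc (-(M : ℤ) + 1) (N : ℤ),
        w i j * dist (v i) (v j) ^ 2 := by
  have key : ∀ n : ℕ, n ≤ N → E (v n) ≤ E (v 0) + (1 / (2 * k)) *
      (∑ i ∈ Finset.Icc (0 : ℤ) n, ∑ j ∈ Finset.Icc (-(M : ℤ) + 1) (N : ℤ),
          w i j * dist (v i) (v j) ^ 2
        - ∑ j ∈ Finset.Icc (-(M : ℤ) + 1) (n - 1 : ℤ),
          γ (n + 1) j * dist (v n) (v j) ^ 2) := by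
    intro n
    induction n with
    | zero =>
      intro _
      have hrow := sum_strictLower_weight_mul γ w hw (fun j => dist (v 0) (v j) ^ 2)
        (a := -(M : ℤ) + 1) (b := N) (i := 0) (by lia)
      simp [hrow, hγ0]
    | succ n ih =>
      intro hn
      have hstep := hmin (n + 1) (Finset.mem_Icc.2 ⟨by lia, by lia⟩)
      have hrow := sum_strictLower_weight_mul γ w hw (fun j => dist (v (n + 1)) (v j) ^ 2)
        (a := -(M : ℤ) + 1) (b := N) (i := n + 1) (by lia)
      have hIcc : Finset.Icc (0 : ℤ) (n + 1) = insert ((n : ℤ) + 1) (Finset.Icc (0 : ℤ) n) := by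
        ext x
        simp only [Finset.mem_Icc, Finset.mem_insert]
        lia
      have hpred : (n : ℤ) + 1 - 2 = n - 1 := by ring
      push_cast
      rw [hIcc, Finset.sum_insert (by simp), hrow]
      rw [hpred, add_sub_cancel_right] at hstep
      rw [add_sub_cancel_right]
      linarith [ih (by lia)]
  simpa [hγN] using key N le_rfl
end

section
/- Let (X,d) be a metric space, let n, m ∈ ℕ, and let v_1,…,v_n ∈ X. Let A be a finite index set, and for each α ∈ A let θ^α : Fin n → Fin n → ℝ be given. Let w : Fin n → Fin n → ℝ satisfy w_{i,j} = Σ_{α∈A} θ^α_{i,j} for all i,j. Suppose that for each α ∈ A: (1) there exist points p^α_1,…,p^α_n ∈ ℝᵐ such that ‖p^α_i − p^α_j‖ = d(v_i,v_j) whenever θ^α_{i,j} ≠ 0; and (2) the matrix Q^α = Σ_{i,j} θ^α_{i,j} (e_i − e_j) ⊗ (e_i − e_j) is negative semidefinite. Then Σ_{i,j} w_{i,j} d(v_i,v_j)² ≤ 0. -/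
open Matrix

/-- The quadratic form of `∑ θ i j (e_i - e_j)(e_i - e_j)ᵀ` is `∑ θ i j (x i - x j)²`. -/
theorem dotProduct_sum_smul_vecMulVec_single_sub_mulVec {ι : Type*} [Fintype ι] [DecidableEq ι]
    (θ : ι → ι → ℝ) (x : ι → ℝ) :
    x ⬝ᵥ (∑ i, ∑ j, θ i j •
      Matrix.vecMulVec ((Pi.single i 1 : ι → ℝ) - Pi.single j 1)
        ((Pi.single i 1 : ι → ℝ) - Pi.single j 1)).mulVec x =
      ∑ i, ∑ j, θ i j * (x i - x j) ^ 2 := by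
  simp only [Matrix.sum_mulVec, dotProduct_sum, Matrix.smul_mulVec, dotProduct_smul,
    Matrix.vecMulVec_mulVec, sub_dotProduct, dotProduct_sub, single_dotProduct,
    dotProduct_single, smul_eq_mul, op_smul_eq_smul, one_mul, mul_one]
  simp only [sq]

/-- If the matrix `∑ θ i j (e_i - e_j)(e_i - e_j)ᵀ` is negative semidefinite, then the weighted sum
of squared distances between points of a Euclidean space is nonpositive. -/
theorem sum_mul_norm_sub_sq_nonpos {ι κ : Type*} [Fintype ι] [DecidableEq ι] [Fintype κ]
    (θ : ι → ι → ℝ)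
    (hθ : ∀ x : ι → ℝ, x ⬝ᵥ (∑ i, ∑ j, θ i j •
      Matrix.vecMulVec ((Pi.single i 1 : ι → ℝ) - Pi.single j 1)
        ((Pi.single i 1 : ι → ℝ) - Pi.single j 1)).mulVec x ≤ 0)
    (p : ι → EuclideanSpace ℝ κ) :
    ∑ i, ∑ j, θ i j * ‖p i - p j‖ ^ 2 ≤ 0 := by
  have hsum : ∑ i, ∑ j, θ i j * ‖p i - p j‖ ^ 2 =
      ∑ k, ∑ i, ∑ j, θ i j * (p i k - p j k) ^ 2 := by
    simp only [EuclideanSpace.real_norm_sq_eq, PiLp.sub_apply, Finset.mul_sum]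
    exact (Finset.sum_congr rfl fun _ _ => Finset.sum_comm).trans Finset.sum_comm
  rw [hsum]
  refine Finset.sum_nonpos fun k _ => ?_
  rw [← dotProduct_sum_smul_vecMulVec_single_sub_mulVec θ fun i => p i k]
  exact hθ _

/-- Graph-decomposition criterion: if `w = ∑_α θ^α`, each subgraph (the support of `θ^α`)
is realized by Euclidean points matching the metric distances, and each matrix
`Q^α = ∑ θ^α_{ij} (e_i - e_j)(e_i - e_j)ᵀ` is negative semidefinite, then
`∑ w_{ij} d(v_i, v_j)² ≤ 0`. -/
theorem weighted_distance_sum_nonpos_of_decomposition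
    {X : Type*} [MetricSpace X] (n m : ℕ) (v : Fin n → X)
    {A : Type*} [Fintype A] (θ : A → Fin n → Fin n → ℝ)
    (w : Fin n → Fin n → ℝ) (hw : ∀ i j : Fin n, w i j = ∑ α : A, θ α i j)
    (hembed : ∀ α : A, ∃ p : Fin n → EuclideanSpace ℝ (Fin m),
      ∀ i j : Fin n, θ α i j ≠ 0 → ‖p i - p j‖ = dist (v i) (v j))
    (hNSD : ∀ α : A, ∀ x : Fin n → ℝ,
      x ⬝ᵥ (∑ i : Fin n, ∑ j : Fin n, θ α i j •
        Matrix.vecMulVec ((Pi.single i 1 : Fin n → ℝ) - Pi.single j 1)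
          ((Pi.single i 1 : Fin n → ℝ) - Pi.single j 1)).mulVec x ≤ 0) :
    ∑ i : Fin n, ∑ j : Fin n, w i j * dist (v i) (v j) ^ 2 ≤ 0 := by
  have hsum : ∑ i, ∑ j, w i j * dist (v i) (v j) ^ 2 =
      ∑ α, ∑ i, ∑ j, θ α i j * dist (v i) (v j) ^ 2 := by
    simp only [hw, Finset.sum_mul]
    exact (Finset.sum_congr rfl fun _ _ => Finset.sum_comm).trans Finset.sum_comm
  rw [hsum]
  refine Finset.sum_nonpos fun α _ => ?_
  obtain ⟨p, hp⟩ := hembed α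
  refine le_of_eq_of_le ?_ (sum_mul_norm_sub_sq_nonpos (θ α) (hNSD α) p)
  refine Finset.sum_congr rfl fun i _ => Finset.sum_congr rfl fun j _ => ?_
  by_cases h : θ α i j = 0
  · simp [h]
  · rw [hp i j h]
end

section
/- Let (X,d) be a metric space, E : X → ℝ, k > 0, M ≥ 2, N ≥ 1, and let γ_{i,j} ∈ ℝ be given for i = 1,…,N, j = −M+1,…,i−1, with γ_{0,j} = γ_{N+1,j} = 0. Define w_{i,j} = γ_{i+1,j} − γ_{i,j} for i > j and 0 for i ≤ j, and for constants 0 ≤ L₁ < L₂ define modified weights w̃ by w̃_{0,−1} = w_{0,−1} − L₁, w̃_{N,0} = w_{N,0} + L₂, and w̃_{i,j} = w_{i,j} for all other (i,j). Suppose v_{−M+1},…,v_N ∈ X satisfy, for each i = 1,…,N, E(v_i) + (1/(2k)) Σ_{j=−M+1}^{i−1} γ_{i,j} d(v_i,v_j)² ≤ E(v_{i−1}) + (1/(2k)) Σ_{j=−M+1}^{i−2} γ_{i,j} d(v_{i−1},v_j)². Suppose further there exist m ∈ ℕ, a finite index set A, and coefficients θ^α_{i,j} with Σ_α θ^α_{i,j}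 = w̃_{i,j}, such that for each α there exist points p^α_{−M+1},…,p^α_N ∈ ℝᵐ with ‖p^α_i − p^α_j‖ = d(v_i,v_j) whenever θ^α_{i,j} ≠ 0, and each matrix Q^α = Σ_{i,j} θ^α_{i,j} (e_{i+M} − e_{j+M}) ⊗ (e_{i+M} − e_{j+M}) is negative semidefinite. Then E(v_N) + (L₂/(2k)) d(v_N,v_0)² ≤ E(v_0) + (L₁/(2k)) d(v_0,v_{−1})². -/
open Matrix

/-- Discrete summation of one-step energy inequalities: if each step `i - 1 → i` satisfies
`F i + c * G i i ≤ F (i - 1) + c * G i (i - 1)`, the inequalities telescope. -/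
theorem energy_telescope (F : ℤ → ℝ) (c : ℝ) (G : ℤ → ℤ → ℝ) (N : ℕ) (hG : G 0 0 = 0)
    (h : ∀ i ∈ Finset.Icc (1 : ℤ) (N : ℤ), F i + c * G i i ≤ F (i - 1) + c * G i (i - 1))
    (n : ℕ) (hn : n ≤ N) :
    F n + c * G (n + 1) n ≤
      F 0 + c * ∑ i ∈ Finset.Icc (0 : ℤ) (n : ℤ), (G (i + 1) i - G i i) := by
  induction n with
  | zero => simp [hG]
  | succ n ih =>
    have ih' := ih (by omega)
    have hstep := h ((n : ℤ) + 1) (by simp only [Finset.mem_Icc]; omega)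
    have hI : Finset.Icc (0 : ℤ) ((n : ℤ) + 1) = insert ((n : ℤ) + 1) (Finset.Icc 0 (n : ℤ)) := by
      ext x
      simp only [Finset.mem_Icc, Finset.mem_insert]
      omega
    push_cast
    rw [hI, Finset.sum_insert (by simp)]
    rw [add_sub_cancel_right] at hstep
    linarith

/-- The quadratic form of a weighted sum of squares of differences. -/
theorem dotProduct_sum_smul_vecMulVec_mulVec {ι κ n R : Type*} [Fintype n] [CommRing R]
    (s : Finset ι) (t : Finset κ) (θ : ι → κ → R) (u : ι → κ → n → R) (x : n → R) :
    x ⬝ᵥ (∑ i ∈ s, ∑ j ∈ t, θ i j • Matrix.vecMulVec (u i j) (u i j)).mulVec x =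
      ∑ i ∈ s, ∑ j ∈ t, θ i j * (u i j ⬝ᵥ x) ^ 2 := by
  simp only [Matrix.sum_mulVec, dotProduct_sum, Matrix.smul_mulVec, Matrix.vecMulVec_mulVec,
    dotProduct_smul]
  refine Finset.sum_congr rfl fun i _ => Finset.sum_congr rfl fun j _ => ?_
  simp [dotProduct_comm x (u i j)]
  ring

/-- If a quadratic form in weighted differences is nonpositive on scalars, it is nonpositive on
points of a Euclidean space. -/
theorem sum_mul_norm_sub_sq_nonpos_s4 {ι : Type*} {m : ℕ} (s t : Finset ι) (θ : ι → ι → ℝ)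
    (h : ∀ y : ι → ℝ, ∑ i ∈ s, ∑ j ∈ t, θ i j * (y i - y j) ^ 2 ≤ 0)
    (p : ι → EuclideanSpace ℝ (Fin m)) :
    ∑ i ∈ s, ∑ j ∈ t, θ i j * ‖p i - p j‖ ^ 2 ≤ 0 := by
  have hsum : ∑ i ∈ s, ∑ j ∈ t, θ i j * ‖p i - p j‖ ^ 2 =
      ∑ l : Fin m, ∑ i ∈ s, ∑ j ∈ t, θ i j * (p i l - p j l) ^ 2 := by
    simp only [EuclideanSpace.real_norm_sq_eq, Finset.mul_sum, PiLp.sub_apply]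
    refine Eq.symm (Finset.sum_comm.trans ?_)
    exact Finset.sum_congr rfl fun i _ => Finset.sum_comm
  rw [hsum]
  exact Finset.sum_nonpos fun l _ => h fun i => p i l

/-- Claim 2 (per-step inequality): relaxed stability of the M-step N-stage mixed variational
scheme with modified weights `w̃`.  For `i ∈ {-M+1, …, N}`, the (1-based) basis vector
`e_{i+M}` of `ℝ^{M+N}` is the indicator of the (0-based) index `i + M - 1` in `Fin (M+N)`. -/
theorem relaxed_stability_per_step
    {X : Type*} [MetricSpace X] (E : X → ℝ) (k : ℝ) (hk : 0 < k)
    (M N : ℕ) (hM : 2 ≤ M) (hN : 1 ≤ N)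
    (γ : ℤ → ℤ → ℝ) (hγ0 : ∀ j : ℤ, γ 0 j = 0) (hγN : ∀ j : ℤ, γ ((N : ℤ) + 1) j = 0)
    (w : ℤ → ℤ → ℝ)
    (hw : ∀ i j : ℤ, w i j = if j < i then γ (i + 1) j - γ i j else 0)
    (L₁ L₂ : ℝ) (hL₁ : 0 ≤ L₁) (hL₁₂ : L₁ < L₂)
    (wt : ℤ → ℤ → ℝ)
    (hwt : ∀ i j : ℤ, wt i j =
      if i = 0 ∧ j = -1 then w i j - L₁
      else if i = (N : ℤ) ∧ j = 0 then w i j + L₂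
      else w i j)
    (v : ℤ → X)
    (hmin : ∀ i ∈ Finset.Icc (1 : ℤ) (N : ℤ),
      E (v i) + (1 / (2 * k)) *
          ∑ j ∈ Finset.Icc (-(M : ℤ) + 1) (i - 1), γ i j * dist (v i) (v j) ^ 2
        ≤ E (v (i - 1)) + (1 / (2 * k)) *
          ∑ j ∈ Finset.Icc (-(M : ℤ) + 1) (i - 2), γ i j * dist (v (i - 1)) (v j) ^ 2)
    (m : ℕ) {A : Type*} [Fintype A] (θ : A → ℤ → ℤ → ℝ)
    (hθw : ∀ i ∈ Finset.Icc (0 : ℤ) (N : ℤ), ∀ j ∈ Finset.Icc (-(M : ℤ) + 1) (N : ℤ),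
      ∑ α : A, θ α i j = wt i j)
    (e : ℤ → Fin (M + N) → ℝ)
    (he : ∀ i : ℤ, ∀ l : Fin (M + N), e i l = if (l : ℤ) = i + (M : ℤ) - 1 then 1 else 0)
    (hembed : ∀ α : A, ∃ p : ℤ → EuclideanSpace ℝ (Fin m),
      ∀ i ∈ Finset.Icc (0 : ℤ) (N : ℤ), ∀ j ∈ Finset.Icc (-(M : ℤ) + 1) (N : ℤ),
        θ α i j ≠ 0 → ‖p i - p j‖ = dist (v i) (v j))
    (hNSD : ∀ α : A, ∀ x : Fin (M + N) → ℝ,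
      x ⬝ᵥ (∑ i ∈ Finset.Icc (0 : ℤ) (N : ℤ), ∑ j ∈ Finset.Icc (-(M : ℤ) + 1) (N : ℤ),
        θ α i j • Matrix.vecMulVec (e i - e j) (e i - e j)).mulVec x ≤ 0) :
    E (v (N : ℤ)) + (L₂ / (2 * k)) * dist (v (N : ℤ)) (v 0) ^ 2
      ≤ E (v 0) + (L₁ / (2 * k)) * dist (v 0) (v (-1)) ^ 2 := by
  have hpair : ∀ i ∈ Finset.Icc (-(M : ℤ) + 1) (N : ℤ), ∀ y : ℤ → ℝ,
      e i ⬝ᵥ (fun l : Fin (M + N) => y ((l : ℤ) - M + 1)) = y i := by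
    intro i hi y
    rw [Finset.mem_Icc] at hi
    rw [dotProduct, Finset.sum_eq_single ⟨(i + M - 1).toNat, by omega⟩]
    · rw [he, if_pos (by simp only; omega), one_mul]
      congr 1
      simp only
      omega
    · intro l _ hl
      rw [he, if_neg, zero_mul]
      intro hc
      apply hl
      ext
      simp only
      omega
    · simp
  have hquad : ∀ α : A, ∀ y : ℤ → ℝ,
      ∑ i ∈ Finset.Icc (0 : ℤ) (N : ℤ), ∑ j ∈ Finset.Icc (-(M : ℤ) + 1) (N : ℤ),
        θ α i j * (y i - y j) ^ 2 ≤ 0 := by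
    intro α y
    have hx := hNSD α (fun l => y ((l : ℤ) - M + 1))
    rw [dotProduct_sum_smul_vecMulVec_mulVec] at hx
    refine le_of_eq_of_le ?_ hx
    refine Finset.sum_congr rfl fun i hi => Finset.sum_congr rfl fun j hj => ?_
    rw [sub_dotProduct, hpair j hj, hpair i]
    rw [Finset.mem_Icc] at hi ⊢
    omega
  have hwt_nonpos : ∑ i ∈ Finset.Icc (0 : ℤ) (N : ℤ), ∑ j ∈ Finset.Icc (-(M : ℤ) + 1) (N : ℤ),
      wt i j * dist (v i) (v j) ^ 2 ≤ 0 := by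
    have hswap : ∑ i ∈ Finset.Icc (0 : ℤ) (N : ℤ), ∑ j ∈ Finset.Icc (-(M : ℤ) + 1) (N : ℤ),
        wt i j * dist (v i) (v j) ^ 2 =
        ∑ α : A, ∑ i ∈ Finset.Icc (0 : ℤ) (N : ℤ), ∑ j ∈ Finset.Icc (-(M : ℤ) + 1) (N : ℤ),
          θ α i j * dist (v i) (v j) ^ 2 := by
      refine Eq.symm (Finset.sum_comm.trans ?_)
      refine Finset.sum_congr rfl fun i hi => Finset.sum_comm.trans ?_
      refine Finset.sum_congr rfl fun j hj => ?_
      rw [← hθw i hi j hj, Finset.sum_mul]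
    rw [hswap]
    refine Finset.sum_nonpos fun α _ => ?_
    obtain ⟨p, hp⟩ := hembed α
    refine le_of_eq_of_le ?_ (sum_mul_norm_sub_sq_nonpos_s4 _ _ (θ α) (hquad α) p)
    refine Finset.sum_congr rfl fun i hi => Finset.sum_congr rfl fun j hj => ?_
    by_cases h0 : θ α i j = 0
    · simp [h0]
    · rw [hp i hi j hj h0]
  have hwt_sum : ∑ i ∈ Finset.Icc (0 : ℤ) (N : ℤ), ∑ j ∈ Finset.Icc (-(M : ℤ) + 1) (N : ℤ),
      wt i j * dist (v i) (v j) ^ 2 =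
      ∑ i ∈ Finset.Icc (0 : ℤ) (N : ℤ), ∑ j ∈ Finset.Icc (-(M : ℤ) + 1) (N : ℤ),
        w i j * dist (v i) (v j) ^ 2
      - L₁ * dist (v 0) (v (-1)) ^ 2 + L₂ * dist (v (N : ℤ)) (v 0) ^ 2 := by
    have hsplit : ∀ i j : ℤ, wt i j * dist (v i) (v j) ^ 2 =
        w i j * dist (v i) (v j) ^ 2
        - (if i = 0 then if j = -1 then L₁ * dist (v i) (v j) ^ 2 else 0 else 0)
        + (if i = (N : ℤ) then if j = 0 then L₂ * dist (v i) (v j) ^ 2 else 0 else 0) := by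
      intro i j
      rw [hwt]
      split_ifs <;> first | omega | ring
    simp only [hsplit, Finset.sum_add_distrib, Finset.sum_sub_distrib]
    congr 2
    · rw [Finset.sum_eq_single 0 (fun i _ hi => by simp [hi])
        (fun h => absurd (by simp) h), Finset.sum_eq_single (-1) (fun j _ hj => by simp [hj])]
      · simp
      · intro h
        exact absurd (by rw [Finset.mem_Icc]; omega) h
    · rw [Finset.sum_eq_single (N : ℤ) (fun i _ hi => by simp [hi])
        (fun h => absurd (by simp) h), Finset.sum_eq_single 0 (fun j _ hj => by simp [hj])]
      · simp
      · intro h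
        exact absurd (by rw [Finset.mem_Icc]; omega) h
  set G : ℤ → ℤ → ℝ := fun a b =>
    ∑ j ∈ Finset.Icc (-(M : ℤ) + 1) (b - 1), γ a j * dist (v b) (v j) ^ 2 with hGdef
  have hG : ∀ i ∈ Finset.Icc (0 : ℤ) (N : ℤ), G (i + 1) i - G i i =
      ∑ j ∈ Finset.Icc (-(M : ℤ) + 1) (N : ℤ), w i j * dist (v i) (v j) ^ 2 := by
    intro i hi
    rw [Finset.mem_Icc] at hi
    simp only [hGdef]
    rw [← Finset.sum_sub_distrib]
    refine Eq.trans ?_ (Finset.sum_subset (Finset.Icc_subset_Icc_right (b₁ := i - 1)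
      (by omega)) ?_)
    · refine Finset.sum_congr rfl fun j hj => ?_
      rw [Finset.mem_Icc] at hj
      rw [hw, if_pos (by omega)]
      ring
    · intro j hj hj'
      rw [Finset.mem_Icc] at hj hj'
      rw [hw, if_neg (by omega), zero_mul]
  have htel := energy_telescope (fun i => E (v i)) (1 / (2 * k)) G N (by simp [hGdef, hγ0])
    (fun i hi => by
      have h := hmin i hi
      simp only [hGdef]
      rwa [show i - 1 - 1 = i - 2 by ring]) N le_rfl
  have hlast : G ((N : ℤ) + 1) N = 0 := by simp [hGdef, hγN]
  rw [hlast, Finset.sum_congr rfl hG] at htel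
  have hbound := mul_le_mul_of_nonneg_left (hwt_sum ▸ hwt_nonpos)
    (by positivity : 0 ≤ 1 / (2 * k))
  rw [div_eq_mul_one_div L₂, div_eq_mul_one_div L₁]
  linarith
end

section
/- Let N ∈ ℕ, and let r_0,…,r_N ≥ 0 and e_0,…,e_{N−1} ≥ 0 satisfy, for every j = 0,…,N−1, the triangle inequalities r_j + r_{j+1} ≥ e_j, r_j + e_j ≥ r_{j+1}, and r_{j+1} + e_j ≥ r_j. Then there exist points h, p_0, p_1, …, p_N ∈ ℝ² such that ‖p_j − h‖ = r_j for every j = 0,…,N and ‖p_{j+1} − p_j‖ = e_j for every j = 0,…,N−1. -/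
/-- In the plane, a segment from the origin can be completed to a triangle with any
prescribed remaining side lengths satisfying the triangle inequalities. -/
theorem exists_norm_eq_norm_sub_eq (x : EuclideanSpace ℝ (Fin 2)) {b c : ℝ}
    (hb : 0 ≤ b) (hc : 0 ≤ c) (h1 : c ≤ ‖x‖ + b) (h2 : b ≤ ‖x‖ + c) (h3 : ‖x‖ ≤ b + c) :
    ∃ y : EuclideanSpace ℝ (Fin 2), ‖y‖ = b ∧ ‖y - x‖ = c := by
  rcases eq_or_ne x 0 with rfl | hx
  · rw [norm_zero] at h1 h2
    have hbc : b = c := by linarith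
    refine ⟨EuclideanSpace.single 0 b, ?_, ?_⟩
    · simp [abs_of_nonneg hb]
    · simp [← hbc, abs_of_nonneg hb]
  have ha : 0 < ‖x‖ := norm_pos_iff.mpr hx
  have hxx : ‖x‖ ^ 2 = x 0 ^ 2 + x 1 ^ 2 := by
    simp [EuclideanSpace.real_norm_sq_eq, Fin.sum_univ_two]
  set a := ‖x‖
  obtain ⟨s, hs⟩ : ∃ s, s * (2 * a ^ 2) = a ^ 2 + b ^ 2 - c ^ 2 :=
    ⟨(a ^ 2 + b ^ 2 - c ^ 2) / (2 * a ^ 2), by field_simp⟩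
  have hsq : 0 ≤ b ^ 2 - a ^ 2 * s ^ 2 := by
    have hprod : 0 ≤ ((a + b + c) * (a + b - c)) * ((c + a - b) * (c + b - a)) :=
      mul_nonneg (mul_nonneg (by linarith) (by linarith))
        (mul_nonneg (by linarith) (by linarith))
    have hfac : ((a + b + c) * (a + b - c)) * ((c + a - b) * (c + b - a))
        = (b ^ 2 - a ^ 2 * s ^ 2) * (4 * a ^ 2) := by
      linear_combination (s * (2 * a ^ 2) + (a ^ 2 + b ^ 2 - c ^ 2)) * hs
    rw [hfac] at hprod
    exact nonneg_of_mul_nonneg_left hprod (by positivity)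
  obtain ⟨t, ht⟩ : ∃ t, a ^ 2 * t ^ 2 = b ^ 2 - a ^ 2 * s ^ 2 :=
    ⟨√(b ^ 2 - a ^ 2 * s ^ 2) / a, by rw [div_pow, Real.sq_sqrt hsq]; field_simp⟩
  refine ⟨!₂[s * x 0 - t * x 1, s * x 1 + t * x 0], ?_, ?_⟩
  · rw [← sq_eq_sq₀ (norm_nonneg _) hb, EuclideanSpace.real_norm_sq_eq, Fin.sum_univ_two]
    simp
    linear_combination ht - (s ^ 2 + t ^ 2) * hxx
  · rw [← sq_eq_sq₀ (norm_nonneg _) hc, EuclideanSpace.real_norm_sq_eq, Fin.sum_univ_two]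
    simp
    linear_combination ht - hs - (s ^ 2 + t ^ 2 - 2 * s + 1) * hxx

/-- Hub-plus-path graphs are embeddable in the plane: given radii `r 0, …, r N` from a hub
and edge lengths `e 0, …, e (N-1)` along a path satisfying the triangle inequalities,
there are points in `ℝ²` realizing all these distances. -/
theorem hub_path_graph_embeddable
    (N : ℕ) (r e : ℕ → ℝ)
    (hr : ∀ j ≤ N, 0 ≤ r j) (he : ∀ j < N, 0 ≤ e j)
    (h1 : ∀ j < N, e j ≤ r j + r (j + 1))
    (h2 : ∀ j < N, r (j + 1) ≤ r j + e j)
    (h3 : ∀ j < N, r j ≤ r (j + 1) + e j) :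
    ∃ (h : EuclideanSpace ℝ (Fin 2)) (p : ℕ → EuclideanSpace ℝ (Fin 2)),
      (∀ j ≤ N, ‖p j - h‖ = r j) ∧ (∀ j < N, ‖p (j + 1) - p j‖ = e j) := by
  refine ⟨0, ?_⟩
  simp only [sub_zero]
  induction N with
  | zero =>
    refine ⟨fun _ => EuclideanSpace.single 0 (r 0), fun j hj => ?_, fun j hj => by omega⟩
    obtain rfl : j = 0 := by omega
    simp [abs_of_nonneg (hr 0 le_rfl)]
  | succ N ih =>
    obtain ⟨p, hp, hpe⟩ := ih (fun j hj => hr j (by omega)) (fun j hj => he j (by omega))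
      (fun j hj => h1 j (by omega)) (fun j hj => h2 j (by omega)) (fun j hj => h3 j (by omega))
    have hN := hp N le_rfl
    obtain ⟨y, hy, hye⟩ := exists_norm_eq_norm_sub_eq (p N) (hr (N + 1) le_rfl)
      (he N (by omega)) (by rw [hN]; exact h1 N (by omega)) (by rw [hN]; exact h2 N (by omega))
      (by rw [hN]; exact h3 N (by omega))
    refine ⟨Function.update p (N + 1) y, fun j hj => ?_, fun j hj => ?_⟩
    · obtain rfl | hj' := eq_or_ne j (N + 1)
      · simpa using hy
      · rw [Function.update_of_ne hj']
        exact hp j (by omega)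
    · rw [Function.update_of_ne (by omega : j ≠ N + 1)]
      obtain rfl | hj' := eq_or_ne j N
      · simpa using hye
      · rw [Function.update_of_ne (by omega : j + 1 ≠ N + 1)]
        exact hpe j (by omega)
end

section
/- Let (X,d) be a metric space and let v_0, v_1, v_2, v_3 ∈ X. Then −5 d(v_1,v_0)² − d(v_2,v_0)² − (33/5) d(v_2,v_1)² + 2 d(v_3,v_0)² + (8/5) d(v_3,v_1)² − (48/5) d(v_3,v_2)² ≤ 0. -/
/-- Nonpositivity, in any metric space, of the weighted sum of squared distances associated
with the energy stable single-step 3-stage scheme. -/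
theorem three_stage_weighted_sum_nonpos
    {X : Type*} [MetricSpace X] (v₀ v₁ v₂ v₃ : X) :
    -5 * dist v₁ v₀ ^ 2 - dist v₂ v₀ ^ 2 - (33 / 5) * dist v₂ v₁ ^ 2
      + 2 * dist v₃ v₀ ^ 2 + (8 / 5) * dist v₃ v₁ ^ 2 - (48 / 5) * dist v₃ v₂ ^ 2 ≤ 0 := by
  have h₃₁ : dist v₃ v₁ ≤ dist v₂ v₁ + dist v₃ v₂ := by
    linarith [dist_triangle v₃ v₂ v₁]
  have h₃₀ : dist v₃ v₀ ≤ dist v₂ v₀ + dist v₃ v₂ := by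
    linarith [dist_triangle v₃ v₂ v₀]
  have h₃₀' : dist v₃ v₀ ≤ dist v₁ v₀ + (dist v₂ v₁ + dist v₃ v₂) := by
    linarith [dist_triangle v₃ v₁ v₀]
  have s₃₁ := pow_le_pow_left₀ dist_nonneg h₃₁ 2
  have s₃₀ := pow_le_pow_left₀ dist_nonneg h₃₀ 2
  have s₃₀' := pow_le_pow_left₀ dist_nonneg h₃₀' 2
  linarith [sq_nonneg (dist v₂ v₀ - 2 * dist v₃ v₂),
    sq_nonneg (11 * dist v₁ v₀ - 4 * (dist v₂ v₁ + dist v₃ v₂)),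
    sq_nonneg (175 * dist v₂ v₁ - 188 * dist v₃ v₂), sq_nonneg (dist v₃ v₂)]
end

section
/- Let (X,d) be a metric space, E : X → ℝ, k > 0, and let v_0, v_1, v_2, v_3 ∈ X satisfy the three inequalities: E(v_1) + (1/(2k))·4 d(v_1,v_0)² ≤ E(v_0); E(v_2) + (1/(2k))·(−d(v_2,v_0)² + 5 d(v_2,v_1)²) ≤ E(v_1) + (1/(2k))·(−d(v_1,v_0)²); and E(v_3) + (1/(2k))·(−2 d(v_3,v_0)² − (8/5) d(v_3,v_1)² + (48/5) d(v_3,v_2)²) ≤ E(v_2) + (1/(2k))·(−2 d(v_2,v_0)² − (8/5) d(v_2,v_1)²). Then E(v_3) ≤ E(v_0). -/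
/-- The total squared-distance contribution of the three stages is nonnegative. -/
theorem three_stage_dissipation_nonneg {X : Type*} [PseudoMetricSpace X] (v₀ v₁ v₂ v₃ : X) :
    0 ≤ 5 * dist v₁ v₀ ^ 2 + (33 / 5) * dist v₂ v₁ ^ 2 + (48 / 5) * dist v₃ v₂ ^ 2
      + dist v₂ v₀ ^ 2 - 2 * dist v₃ v₀ ^ 2 - (8 / 5) * dist v₃ v₁ ^ 2 := by
  have hq := dist_triangle v₃ v₂ v₁
  have hr := dist_triangle v₃ v₂ v₀
  have hp := dist_triangle v₂ v₁ v₀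
  have ha : 0 ≤ dist v₁ v₀ := dist_nonneg
  have hb : 0 ≤ dist v₂ v₁ := dist_nonneg
  have hc : 0 ≤ dist v₃ v₂ := dist_nonneg
  have hp0 : 0 ≤ dist v₂ v₀ := dist_nonneg
  have hq0 : 0 ≤ dist v₃ v₁ := dist_nonneg
  have hr0 : 0 ≤ dist v₃ v₀ := dist_nonneg
  generalize dist v₁ v₀ = a at *
  generalize dist v₂ v₁ = b at *
  generalize dist v₃ v₂ = c at *
  generalize dist v₂ v₀ = p at *
  generalize dist v₃ v₁ = q at *
  generalize dist v₃ v₀ = r at *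
  have hq2 : q ^ 2 ≤ (c + b) ^ 2 := by gcongr
  have hr2 : r ^ 2 ≤ (c + p) ^ 2 := by gcongr
  have hp2 : p ^ 2 ≤ (b + a) ^ 2 := by gcongr
  have hpc : p * c ≤ (b + a) * c := by gcongr
  nlinarith [sq_nonneg (a - b / 4 - c / 2), sq_nonneg (b - 82 / 75 * c), sq_nonneg c]

/-- Unconditional energy stability of the single-step 3-stage variational scheme with
coefficients `γ_{1,0} = 4, γ_{2,0} = -1, γ_{2,1} = 5, γ_{3,0} = -2, γ_{3,1} = -8/5,
γ_{3,2} = 48/5`. -/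
theorem three_stage_scheme_energy_stable
    {X : Type*} [MetricSpace X] (E : X → ℝ) (k : ℝ) (hk : 0 < k)
    (v₀ v₁ v₂ v₃ : X)
    (h1 : E v₁ + (1 / (2 * k)) * (4 * dist v₁ v₀ ^ 2) ≤ E v₀)
    (h2 : E v₂ + (1 / (2 * k)) * (-dist v₂ v₀ ^ 2 + 5 * dist v₂ v₁ ^ 2)
      ≤ E v₁ + (1 / (2 * k)) * (-dist v₁ v₀ ^ 2))
    (h3 : E v₃ + (1 / (2 * k)) *
        (-2 * dist v₃ v₀ ^ 2 - (8 / 5) * dist v₃ v₁ ^ 2 + (48 / 5) * dist v₃ v₂ ^ 2)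
      ≤ E v₂ + (1 / (2 * k)) * (-2 * dist v₂ v₀ ^ 2 - (8 / 5) * dist v₂ v₁ ^ 2)) :
    E v₃ ≤ E v₀ := by
  have hD := mul_nonneg (by positivity : 0 ≤ 1 / (2 * k))
    (three_stage_dissipation_nonneg v₀ v₁ v₂ v₃)
  linarith
end
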